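/- Consider a finite deterministic MDP with reward function r : S × A → ℝ, transition function T : S × A → S, and discount factor γ ∈ (0,1), and define the bottleneck (min-operation) Bellman operator by (FQ)(s,a) = min(r(s,a), γ · max_{a' ∈ A} Q(T(s,a), a')). Then F is a contraction with Lipschitz constant γ in the supremum norm on value functions, it has a unique fixed point Q*, and for every initial value function Q⁰ : S × A → ℝ the iterates Fⁿ Q⁰ converge to Q* as n → ∞. -/

import Mathlib

open Finset Filter

theorem abs_sup'_sub_sup'_le {ι : Type*} {s : Finset ι} (hs : s.Nonempty) {f g : ι → ℝ} {c : ℝ}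
    (h : ∀ i ∈ s, |f i - g i| ≤ c) : |s.sup' hs f - s.sup' hs g| ≤ c := by
  rw [abs_sub_le_iff, sub_le_iff_le_add, sub_le_iff_le_add]
  constructor <;> refine Finset.sup'_le hs _ fun i hi => ?_
  · linarith [(abs_sub_le_iff.1 (h i hi)).1, Finset.le_sup' g hi]
  · linarith [(abs_sub_le_iff.1 (h i hi)).2, Finset.le_sup' f hi]

theorem bottleneck_bellman_operator_contraction_and_convergence
    {S A : Type*} [Fintype S] [Nonempty S] [Fintype A] [Nonempty A]
    (r : S × A → ℝ) (T : S × A → S)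
    (γ : ℝ) (hγ : γ ∈ Set.Ioo (0 : ℝ) 1)
    (F : (S × A → ℝ) → (S × A → ℝ))
    (hF : ∀ (Q : S × A → ℝ) (sa : S × A),
      F Q sa = min (r sa) (γ * univ.sup' univ_nonempty (fun a' => Q (T sa, a')))) :
    (∀ Q1 Q2 : S × A → ℝ, ‖F Q1 - F Q2‖ ≤ γ * ‖Q1 - Q2‖) ∧
    (∃ Qstar : S × A → ℝ,
      F Qstar = Qstar ∧
      (∀ Q : S × A → ℝ, F Q = Q → Q = Qstar) ∧
      (∀ Q0 : S × A → ℝ, Tendsto (fun n => F^[n] Q0) atTop (nhds Qstar))) := by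
  have hcontr : ∀ Q1 Q2 : S × A → ℝ, ‖F Q1 - F Q2‖ ≤ γ * ‖Q1 - Q2‖ := by
    intro Q1 Q2
    have hnonneg : 0 ≤ γ * ‖Q1 - Q2‖ := mul_nonneg hγ.1.le (norm_nonneg _)
    refine (pi_norm_le_iff_of_nonneg hnonneg).2 fun sa => ?_
    rw [Pi.sub_apply, hF, hF, Real.norm_eq_abs]
    refine (abs_min_sub_min_le_max _ _ _ _).trans (max_le (by simpa using hnonneg) ?_)
    rw [← mul_sub, abs_mul, abs_of_pos hγ.1]
    exact mul_le_mul_of_nonneg_left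
      (abs_sup'_sub_sup'_le _ fun a _ => norm_le_pi_norm (Q1 - Q2) (T sa, a)) hγ.1.le
  have hF_contracting : ContractingWith ⟨γ, hγ.1.le⟩ F :=
    ⟨hγ.2, LipschitzWith.of_dist_le_mul fun Q1 Q2 => by
      rw [dist_eq_norm, dist_eq_norm]
      exact hcontr Q1 Q2⟩
  exact ⟨hcontr, hF_contracting.fixedPoint F, hF_contracting.fixedPoint_isFixedPt,
    fun _ hQ => hF_contracting.fixedPoint_unique hQ,
    hF_contracting.tendsto_iterate_fixedPoint⟩
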